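/- Let R be a commutative ring containing the rational numbers as a subring (i.e. R is a commutative ℚ-algebra) and let L be a Lie algebra over R (with arbitrary underlying R-module). Consider the R-linear map ẽ : T(L) → U[L] from the tensor algebra to the universal enveloping algebra determined on the n-th tensor power by ẽ(x₁ ⊗ ⋯ ⊗ xₙ) = (1/n!) Σ_{σ ∈ Sₙ} ι(x_{σ(1)}) ⋯ ι(x_{σ(n)}) (and ẽ = id on the degree-0 part R). Then ẽ vanishes on the two-sided ideal of T(L) generated by the elements x ⊗ y − y ⊗ x (x, y ∈ L), hence induces an R-linear map e : S(L) → U[L] on the symmetric algebra S(L), and this induced map e (the classical Poincaré symmetrization map) is an isomorphism of R-modules. -/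

import Mathlib

open TensorAlgebra in
/-- The relation on the tensor algebra whose induced ring quotient is the
symmetric algebra `S(L)`: it identifies `ι x * ι y` with `ι y * ι x`, so that
the kernel of the quotient map is the two-sided ideal generated by the
elements `x ⊗ y − y ⊗ x`. -/
def symRel (R : Type*) [CommRing R] (L : Type*) [AddCommGroup L] [Module R L] :
    TensorAlgebra R L → TensorAlgebra R L → Prop :=
  fun u v => ∃ x y : L, u = ι R x * ι R y ∧ v = ι R y * ι R x

section

open Finset

section Polarization

/-- A polynomial with coefficients in a module over a `ℚ`-algebra that vanishes at all natural
numbers has vanishing coefficients. -/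
theorem eq_zero_of_forall_sum_natCast_pow_smul_eq_zero {M : Type*} [AddCommGroup M] [Module ℚ M]
    {N : ℕ} {m : ℕ → M} (h : ∀ k : ℕ, ∑ i ∈ range N, (k : ℚ) ^ i • m i = 0)
    {i : ℕ} (hi : i < N) : m i = 0 := by
  rw [← Module.forall_dual_apply_eq_zero_iff ℚ]
  intro φ
  set p : Polynomial ℚ := ∑ i ∈ range N, Polynomial.monomial i (φ (m i)) with hp
  have hp0 : p = 0 := by
    refine Polynomial.eq_zero_of_infinite_isRoot p
      ((Set.infinite_range_of_injective (Nat.cast_injective (R := ℚ))).mono ?_)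
    rintro _ ⟨k, rfl⟩
    have := congrArg φ (h k)
    simpa [hp, Polynomial.IsRoot, Polynomial.eval_finsetSum, mul_comm] using this
  have := congrArg (fun q => Polynomial.coeff q i) hp0
  simpa [hp, Polynomial.finsetSum_coeff, Polynomial.coeff_monomial, hi] using this

theorem Polynomial.coeff_one_C_add_C_mul_X_pow_succ {A : Type*} [Ring A] (a b : A) (n : ℕ) :
    ((C a + C b * X) ^ (n + 1)).coeff 1 = ∑ p ∈ antidiagonal n, a ^ p.1 * b * a ^ p.2 := by
  have h0 : ∀ n, ((C a + C b * X) ^ n).coeff 0 = a ^ n := by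
    intro n
    induction n with
    | zero => simp
    | succ n ih => rw [pow_succ, mul_add, ← mul_assoc]; simp [ih, pow_succ]
  induction n with
  | zero => simp
  | succ n ih =>
    rw [pow_succ, mul_add, ← mul_assoc, coeff_add, coeff_mul_C, coeff_mul_X, coeff_mul_C, h0, ih,
      Finset.Nat.sum_antidiagonal_succ', Finset.sum_mul, add_comm]
    simp [pow_succ, mul_assoc]

/-- If a submodule contains all powers `(a + k b) ^ (n + 1)`, it contains their linearization. -/
theorem Submodule.sum_pow_mul_mul_pow_mem {R A : Type*} [CommRing R] [Algebra ℚ R] [Ring A]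
    [Algebra R A] (P : Submodule R A) (a b : A) (n : ℕ)
    (h : ∀ k : ℕ, (a + k • b) ^ (n + 1) ∈ P) :
    ∑ p ∈ antidiagonal n, a ^ p.1 * b * a ^ p.2 ∈ P := by
  let _ : Module ℚ (A ⧸ P) := Module.compHom _ (algebraMap ℚ R)
  have hq : ∀ (q : ℚ) (v : A ⧸ P), q • v = algebraMap ℚ R q • v := fun _ _ => rfl
  set f : Polynomial A := (Polynomial.C a + Polynomial.C b * Polynomial.X) ^ (n + 1) with hf
  rw [← Polynomial.coeff_one_C_add_C_mul_X_pow_succ, ← hf, ← Submodule.Quotient.mk_eq_zero]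
  refine eq_zero_of_forall_sum_natCast_pow_smul_eq_zero (N := f.natDegree + 2)
    (m := fun i => Submodule.Quotient.mk (f.coeff i)) (fun k => ?_) (by omega)
  let φ := Polynomial.eval₂RingHom' (RingHom.id A) (k : A) (fun x => (Nat.cast_commute k x).symm)
  have hφ : φ f = (a + k • b) ^ (n + 1) := by
    have hC : ∀ x, φ (Polynomial.C x) = x := fun x => Polynomial.eval₂_C _ _
    have hX : φ Polynomial.X = k := Polynomial.eval₂_X _ _
    rw [hf, map_pow, map_add, map_mul, hC, hC, hX, nsmul_eq_mul, Nat.cast_comm]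
  have hsum : φ f = ∑ i ∈ range (f.natDegree + 2), ((k : R) ^ i) • f.coeff i := by
    refine (Polynomial.eval₂_eq_sum_range' _ (by omega) _).trans (sum_congr rfl fun i _ => ?_)
    rw [Algebra.smul_def, map_pow, map_natCast, RingHom.id_apply]
    exact ((Nat.cast_commute k (f.coeff i)).symm.pow_right i)
  have hk := h k
  rw [← hφ, hsum, ← Submodule.Quotient.mk_eq_zero, ← Submodule.mkQ_apply, map_sum] at hk
  simpa [hq] using hk

end Polarization

section Bernoulli

open PowerSeries

/-- The exponential Bernoulli coefficient `Bₙ / n!` in a `ℚ`-algebra. -/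
noncomputable def bernoulliCoeff (A : Type*) [CommRing A] [Algebra ℚ A] (n : ℕ) : A :=
  algebraMap ℚ A (bernoulli n / n.factorial)

theorem coeff_rescale_bernoulliPowerSeries {A : Type*} [CommRing A] [Algebra ℚ A] (u : A) (n : ℕ) :
    coeff n (rescale u (bernoulliPowerSeries A)) = bernoulliCoeff A n * u ^ n := by
  simp [bernoulliPowerSeries, bernoulliCoeff, coeff_rescale, mul_comm]

theorem map_bernoulliCoeff {A B : Type*} [CommRing A] [Algebra ℚ A] [CommRing B] [Algebra ℚ B]
    (f : A →ₐ[ℚ] B) (n : ℕ) : f (bernoulliCoeff A n) = bernoulliCoeff B n :=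
  f.commutes _

/-- The divided difference of the exponential generating function of the Bernoulli numbers. -/
noncomputable def bernoulliDividedDifference {A : Type*} [CommRing A] [Algebra ℚ A] (u s : A) :
    PowerSeries A :=
  mk fun n => bernoulliCoeff A (n + 1) * ∑ p ∈ antidiagonal n, u ^ p.1 * s ^ p.2

theorem X_mul_C_mul_bernoulliDividedDifference {A : Type*} [CommRing A] [Algebra ℚ A] (u s : A) :
    X * C (u - s) * bernoulliDividedDifference u s =
      rescale u (bernoulliPowerSeries A) - rescale s (bernoulliPowerSeries A) := by
  ext n
  rw [map_sub (coeff n), coeff_rescale_bernoulliPowerSeries,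
    coeff_rescale_bernoulliPowerSeries, mul_assoc]
  cases n with
  | zero => simp
  | succ n =>
    rw [coeff_succ_X_mul, coeff_C_mul, bernoulliDividedDifference, coeff_mk, ← mul_sub,
      ← (Commute.all u s).mul_geom_sum₂, Finset.Nat.sum_antidiagonal_eq_sum_range_succ_mk]
    simp only [Nat.succ_eq_add_one, Nat.add_sub_cancel]
    ring

theorem bernoulli_two_variable_of_isDomain {A : Type*} [CommRing A] [IsDomain A] [Algebra ℚ A]
    {s t : A} (hs : s ≠ 0) (ht : t ≠ 0) (hst : s + t ≠ 0) :
    - (rescale t (bernoulliPowerSeries A) * bernoulliDividedDifference (s + t) s)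
      - rescale s (bernoulliPowerSeries A) * bernoulliDividedDifference (s + t) t =
      rescale (s + t) (bernoulliPowerSeries A) := by
  have hE : ∀ u : A, rescale u (bernoulliPowerSeries A) * (rescale u (exp A) - 1) = C u * X := by
    intro u
    simpa [rescale_X] using congrArg (rescale u) (bernoulliPowerSeries_mul_exp_sub_one A)
  have hC : ∀ u : A, u ≠ 0 → (C u * X : PowerSeries A) ≠ 0 := fun u hu =>
    mul_ne_zero ((map_ne_zero_iff _ C_injective).2 hu) X_ne_zero
  have hE0 : ∀ u : A, u ≠ 0 → rescale u (exp A) - 1 ≠ 0 := fun u hu h =>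
    hC u hu (by rw [← hE, h, mul_zero])
  have hadd := exp_mul_exp_eq_exp_add s t
  have hDs := X_mul_C_mul_bernoulliDividedDifference (s + t) s
  have hDt := X_mul_C_mul_bernoulliDividedDifference (s + t) t
  rw [add_sub_cancel_left] at hDs
  rw [add_sub_cancel_right] at hDt
  have h0 := mul_ne_zero (mul_ne_zero (hC s hs) ((map_ne_zero_iff _ C_injective).2 ht))
    (mul_ne_zero (mul_ne_zero (hE0 s hs) (hE0 t ht)) (hE0 _ hst))
  have hs' := hE s
  have ht' := hE t
  have hu' := hE (s + t)
  refine mul_left_cancel₀ h0 ?_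
  rw [map_add] at hu'
  generalize bernoulliDividedDifference (s + t) s = Ds at *
  generalize bernoulliDividedDifference (s + t) t = Dt at *
  generalize rescale (s + t) (bernoulliPowerSeries A) = u at *
  generalize rescale s (bernoulliPowerSeries A) = a at *
  generalize rescale t (bernoulliPowerSeries A) = b at *
  rw [← hadd] at hu' ⊢
  generalize rescale s (exp A) = x at *
  generalize rescale t (exp A) = y at *
  generalize (C s : PowerSeries A) = S at *
  generalize (C t : PowerSeries A) = T at *
  have key : (- (b * S * (u - a)) - a * T * (u - b) - S * X * T * u) *
      ((x - 1) * (y - 1) * (x * y - 1)) = 0 := by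
    linear_combination (-S * (x - 1)) * ((u * (x * y - 1)) * ht' + T * X * hu')
      + (S * (x * y - 1)) * ((a * (x - 1)) * ht' + T * X * hs')
      - (T * (y - 1)) * ((u * (x * y - 1)) * hs' + S * X * hu')
      + (T * (x * y - 1)) * ((a * (x - 1)) * ht' + T * X * hs')
      - S * X * T * (x - 1) * (y - 1) * hu'
  linear_combination key + ((x - 1) * (y - 1) * (x * y - 1)) * (- (b * S) * hDs - a * T * hDt)

theorem bernoulliCoeff_two_variable {A : Type*} [CommRing A] [Algebra ℚ A] (s t : A) (m : ℕ) :
    - (∑ k ∈ antidiagonal m, bernoulliCoeff A k.1 * t ^ k.1 *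
        (bernoulliCoeff A (k.2 + 1) * ∑ p ∈ antidiagonal k.2, (s + t) ^ p.1 * s ^ p.2))
      - ∑ k ∈ antidiagonal m, bernoulliCoeff A k.1 * s ^ k.1 *
        (bernoulliCoeff A (k.2 + 1) * ∑ p ∈ antidiagonal k.2, (s + t) ^ p.1 * t ^ p.2) =
      bernoulliCoeff A m * (s + t) ^ m := by
  let X₀ : MvPolynomial (Fin 2) ℚ := MvPolynomial.X 0
  let X₁ : MvPolynomial (Fin 2) ℚ := MvPolynomial.X 1
  have hX : X₀ + X₁ ≠ 0 := fun h => by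
    have := congrArg (MvPolynomial.eval (fun _ => (1 : ℚ))) h
    norm_num [X₀, X₁] at this
  have h := congrArg (coeff m) (bernoulli_two_variable_of_isDomain
    (MvPolynomial.X_ne_zero (R := ℚ) (0 : Fin 2)) (MvPolynomial.X_ne_zero (R := ℚ) (1 : Fin 2)) hX)
  have h' := congrArg (MvPolynomial.aeval ![s, t]) h
  simpa [coeff_mul, coeff_rescale_bernoulliPowerSeries, bernoulliDividedDifference,
    -coeff_rescale, map_bernoulliCoeff] using h'

end Bernoulli

section LieIdentity

variable {R L : Type*} [CommRing R] [LieRing L] [LieAlgebra R L]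

/-- The linear map sending `s ^ a * t ^ b` to `⁅(ad y) ^ a x, (ad y) ^ b z⁆`. -/
noncomputable def bracketEval (x y z : L) : MvPolynomial (Fin 2) R →ₗ[R] L :=
  (MvPolynomial.basisMonomials (Fin 2) R).constr R fun m =>
    ⁅(LieAlgebra.ad R L y ^ m 0) x, (LieAlgebra.ad R L y ^ m 1) z⁆

theorem bracketEval_X_pow_mul_X_pow (x y z : L) (a b : ℕ) :
    bracketEval (R := R) x y z (MvPolynomial.X 0 ^ a * MvPolynomial.X 1 ^ b) =
      ⁅(LieAlgebra.ad R L y ^ a) x, (LieAlgebra.ad R L y ^ b) z⁆ := by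
  have h : (MvPolynomial.X 0 ^ a * MvPolynomial.X 1 ^ b : MvPolynomial (Fin 2) R) =
      MvPolynomial.basisMonomials (Fin 2) R (Finsupp.single 0 a + Finsupp.single 1 b) := by
    simp [MvPolynomial.X_pow_eq_monomial, MvPolynomial.monomial_mul]
  rw [h, bracketEval, Module.Basis.constr_basis]
  simp

theorem bracketEval_add_mul (x y z : L) (f : MvPolynomial (Fin 2) R) :
    bracketEval x y z ((MvPolynomial.X 0 + MvPolynomial.X 1) * f) =
      LieAlgebra.ad R L y (bracketEval x y z f) := by
  induction f using MvPolynomial.induction_on' with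
  | add p q hp hq => rw [mul_add, map_add, hp, hq, map_add, map_add]
  | monomial u r =>
    have h : MvPolynomial.monomial u r =
        r • (MvPolynomial.X 0 ^ u 0 * MvPolynomial.X 1 ^ u 1) := by
      rw [MvPolynomial.monomial_eq, MvPolynomial.smul_eq_C_mul,
        Finsupp.prod_fintype _ _ fun _ => pow_zero _, Fin.prod_univ_two]
    rw [h, mul_smul_comm, map_smul, map_smul, map_smul, add_mul, ← mul_assoc, ← pow_succ',
      mul_left_comm, ← pow_succ', map_add, bracketEval_X_pow_mul_X_pow,
      bracketEval_X_pow_mul_X_pow, bracketEval_X_pow_mul_X_pow, LieAlgebra.ad_apply, leibniz_lie,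
      pow_succ', pow_succ', Module.End.mul_apply, Module.End.mul_apply, LieAlgebra.ad_apply,
      LieAlgebra.ad_apply]

theorem bracketEval_add_pow_mul (x y z : L) (n : ℕ) (f : MvPolynomial (Fin 2) R) :
    bracketEval x y z ((MvPolynomial.X 0 + MvPolynomial.X 1) ^ n * f) =
      (LieAlgebra.ad R L y ^ n) (bracketEval x y z f) := by
  induction n with
  | zero => simp
  | succ n ih => rw [pow_succ', mul_assoc, bracketEval_add_mul, ih, pow_succ', Module.End.mul_apply]

theorem sum_bernoulliCoeff_smul_ad_pow_lie [Algebra ℚ R] (x y z : L) (m : ℕ) :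
    ∑ k ∈ antidiagonal m, (bernoulliCoeff R k.1 * bernoulliCoeff R (k.2 + 1)) •
        ∑ p ∈ antidiagonal k.2, (LieAlgebra.ad R L y ^ p.1)
          ⁅(LieAlgebra.ad R L y ^ k.1) z, (LieAlgebra.ad R L y ^ p.2) x⁆ -
      ∑ k ∈ antidiagonal m, (bernoulliCoeff R k.1 * bernoulliCoeff R (k.2 + 1)) •
        ∑ p ∈ antidiagonal k.2, (LieAlgebra.ad R L y ^ p.1)
          ⁅(LieAlgebra.ad R L y ^ k.1) x, (LieAlgebra.ad R L y ^ p.2) z⁆ =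
      bernoulliCoeff R m • (LieAlgebra.ad R L y ^ m) ⁅x, z⁆ := by
  have hC : ∀ n, bernoulliCoeff (MvPolynomial (Fin 2) R) n =
      algebraMap R _ (bernoulliCoeff R n) := fun n =>
    IsScalarTower.algebraMap_apply ℚ R (MvPolynomial (Fin 2) R) _
  have h := congrArg (bracketEval (R := R) x y z)
    (bernoulliCoeff_two_variable (MvPolynomial.X 0) (MvPolynomial.X 1) m)
  have h₁ : ∀ k : ℕ × ℕ, bracketEval (R := R) x y z (bernoulliCoeff _ k.1 * MvPolynomial.X 1 ^ k.1 *
      (bernoulliCoeff _ (k.2 + 1) * ∑ p ∈ antidiagonal k.2,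
        (MvPolynomial.X 0 + MvPolynomial.X 1) ^ p.1 * MvPolynomial.X 0 ^ p.2)) =
      - ((bernoulliCoeff R k.1 * bernoulliCoeff R (k.2 + 1)) •
        ∑ p ∈ antidiagonal k.2, (LieAlgebra.ad R L y ^ p.1)
          ⁅(LieAlgebra.ad R L y ^ k.1) z, (LieAlgebra.ad R L y ^ p.2) x⁆) := by
    intro k
    rw [hC, hC, mul_mul_mul_comm, ← map_mul, ← Algebra.smul_def, map_smul, mul_sum, map_sum,
      ← smul_neg, ← sum_neg_distrib]
    congr 1
    refine sum_congr rfl fun p _ => ?_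
    rw [mul_comm, mul_assoc, bracketEval_add_pow_mul, bracketEval_X_pow_mul_X_pow, ← lie_skew,
      map_neg]
  have h₂ : ∀ k : ℕ × ℕ, bracketEval (R := R) x y z (bernoulliCoeff _ k.1 * MvPolynomial.X 0 ^ k.1 *
      (bernoulliCoeff _ (k.2 + 1) * ∑ p ∈ antidiagonal k.2,
        (MvPolynomial.X 0 + MvPolynomial.X 1) ^ p.1 * MvPolynomial.X 1 ^ p.2)) =
      (bernoulliCoeff R k.1 * bernoulliCoeff R (k.2 + 1)) •
        ∑ p ∈ antidiagonal k.2, (LieAlgebra.ad R L y ^ p.1)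
          ⁅(LieAlgebra.ad R L y ^ k.1) x, (LieAlgebra.ad R L y ^ p.2) z⁆ := by
    intro k
    rw [hC, hC, mul_mul_mul_comm, ← map_mul, ← Algebra.smul_def, map_smul, mul_sum, map_sum]
    congr 1
    refine sum_congr rfl fun p _ => ?_
    rw [mul_left_comm, bracketEval_add_pow_mul, bracketEval_X_pow_mul_X_pow]
  have h₃ : bracketEval (R := R) x y z (bernoulliCoeff _ m *
      (MvPolynomial.X 0 + MvPolynomial.X 1) ^ m) =
      bernoulliCoeff R m • (LieAlgebra.ad R L y ^ m) ⁅x, z⁆ := by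
    have h0 := bracketEval_X_pow_mul_X_pow (R := R) x y z 0 0
    have h1 := bracketEval_add_pow_mul (R := R) x y z m
      (MvPolynomial.X 0 ^ 0 * MvPolynomial.X 1 ^ 0)
    rw [h0] at h1
    rw [hC, ← Algebra.smul_def, map_smul]
    simpa using congrArg (bernoulliCoeff R m • ·) h1
  rw [h₃, map_sub, map_neg, map_sum, map_sum, sum_congr rfl fun k _ => h₁ k,
    sum_congr rfl fun k _ => h₂ k, sum_neg_distrib, neg_neg] at h
  exact h

end LieIdentity

section Symmetric

open TensorProduct

theorem Finset.sum_antidiagonal_sum_antidiagonal_assoc {M : Type*} [AddCommMonoid M] (n : ℕ)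
    (f : ℕ → ℕ → ℕ → M) :
    ∑ p ∈ antidiagonal n, ∑ q ∈ antidiagonal p.1, f q.1 q.2 p.2 =
      ∑ p ∈ antidiagonal n, ∑ q ∈ antidiagonal p.2, f p.1 q.2 q.1 := by
  rw [sum_sigma', sum_sigma']
  refine sum_bij' (fun x _ => ⟨(x.2.1, x.2.2 + x.1.2), (x.1.2, x.2.2)⟩)
    (fun x _ => ⟨(x.1.1 + x.2.2, x.2.1), (x.1.1, x.2.2)⟩) ?_ ?_ ?_ ?_
    (fun _ _ => rfl) <;>
  · rintro ⟨⟨i, j⟩, ⟨a, b⟩⟩ h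
    simp only [mem_sigma, HasAntidiagonal.mem_antidiagonal] at h ⊢
    grind

theorem Finset.sum_antidiagonal_pow_mul_mul_pow {A : Type*} [CommRing A] (a b : A) (n : ℕ) :
    ∑ p ∈ antidiagonal n, a ^ p.1 * b * a ^ p.2 = ((n + 1 : ℕ) : A) * (b * a ^ n) := by
  have : ∀ p ∈ antidiagonal n, a ^ p.1 * b * a ^ p.2 = b * a ^ n := fun p hp => by
    rw [← HasAntidiagonal.mem_antidiagonal.1 hp]; ring
  rw [sum_congr rfl this, sum_const, Finset.Nat.card_antidiagonal, nsmul_eq_mul]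

/-- The linear endomorphism of the symmetric algebra multiplying the degree `n` part by `b n`. -/
noncomputable def SymmetricAlgebra.degreeScale {R L : Type*} [CommRing R] [AddCommGroup L]
    [Module R L] (b : ℕ → R) : SymmetricAlgebra R L →ₗ[R] SymmetricAlgebra R L :=
  Polynomial.lsum (fun n => b n • LinearMap.id) ∘ₗ
    (SymmetricAlgebra.lift ((Polynomial.monomial 1).restrictScalars R ∘ₗ SymmetricAlgebra.ι R L :
      L →ₗ[R] Polynomial (SymmetricAlgebra R L))).toLinearMap

theorem SymmetricAlgebra.degreeScale_pow {R L : Type*} [CommRing R] [AddCommGroup L] [Module R L]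
    (b : ℕ → R) (y : L) (n : ℕ) :
    SymmetricAlgebra.degreeScale b (SymmetricAlgebra.ι R L y ^ n) =
      b n • SymmetricAlgebra.ι R L y ^ n := by
  simp [SymmetricAlgebra.degreeScale]

variable (R : Type*) [CommRing R] [Algebra ℚ R]

/-- The divided power `a ^ n / n!` in an algebra over a `ℚ`-algebra. -/
noncomputable def dividedPow {A : Type*} [Ring A] [Algebra R A] (a : A) (n : ℕ) : A :=
  algebraMap ℚ R (n.factorial : ℚ)⁻¹ • a ^ n

theorem factorial_smul_dividedPow {A : Type*} [Ring A] [Algebra R A] (a : A) (n : ℕ) :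
    (n.factorial : R) • dividedPow R a n = a ^ n := by
  rw [dividedPow, smul_smul, ← map_natCast (algebraMap ℚ R), ← map_mul,
    mul_inv_cancel₀ (by positivity), map_one, one_smul]

theorem dividedPow_add {A : Type*} [Ring A] [Algebra R A] {a b : A} (h : Commute a b) (n : ℕ) :
    dividedPow R (a + b) n = ∑ p ∈ antidiagonal n, dividedPow R a p.1 * dividedPow R b p.2 := by
  rw [dividedPow, h.add_pow', smul_sum]
  refine sum_congr rfl fun p hp => ?_
  rw [dividedPow, dividedPow, smul_mul_smul_comm, ← Nat.cast_smul_eq_nsmul R, smul_smul,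
    ← map_natCast (algebraMap ℚ R), ← map_mul, ← map_mul]
  congr 2
  obtain rfl := HasAntidiagonal.mem_antidiagonal.1 hp
  rw [Nat.cast_add_choose]
  field_simp

theorem map_dividedPow {A B : Type*} [Ring A] [Algebra R A] [Ring B] [Algebra R B]
    (f : A →ₐ[R] B) (a : A) (n : ℕ) : f (dividedPow R a n) = dividedPow R (f a) n := by
  rw [dividedPow, map_smul, map_pow, dividedPow]

variable {R}

theorem eq_of_natCast_succ_smul_eq {M : Type*} [AddCommGroup M] [Module R M] {n : ℕ} {a b : M}
    (h : ((n + 1 : ℕ) : R) • a = ((n + 1 : ℕ) : R) • b) : a = b := by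
  have := congrArg (algebraMap ℚ R ((n + 1 : ℕ) : ℚ)⁻¹ • ·) h
  simp only [smul_smul] at this
  rwa [← map_natCast (algebraMap ℚ R), ← map_mul, inv_mul_cancel₀ (by positivity), map_one,
    one_smul, one_smul] at this

namespace SymmetricAlgebra

section Module

variable {L : Type*} [AddCommGroup L] [Module R L]

/-- Over a `ℚ`-algebra, the symmetric algebra is spanned by powers of elements of degree one. -/
theorem span_range_pow : Submodule.span R
    (Set.range fun p : L × ℕ => ι R L p.1 ^ p.2) = ⊤ := by
  set P := Submodule.span R (Set.range fun p : L × ℕ => ι R L p.1 ^ p.2) with hP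
  have hmem : ∀ y n, ι R L y ^ n ∈ P := fun y n => Submodule.subset_span ⟨(y, n), rfl⟩
  have hι : ∀ w, ∀ f ∈ P, ι R L w * f ∈ P := by
    intro w f hf
    induction hf using Submodule.span_induction with
    | zero => simp
    | add f g _ _ hf hg => rw [mul_add]; exact P.add_mem hf hg
    | smul r f _ hf => rw [mul_smul_comm]; exact P.smul_mem _ hf
    | mem f hf =>
      obtain ⟨⟨y, n⟩, rfl⟩ := hf
      have h := P.sum_pow_mul_mul_pow_mem (ι R L y) (ι R L w) n fun k => by
        rw [← map_nsmul, ← map_add]; exact hmem _ _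
      rw [sum_antidiagonal_pow_mul_mul_pow, ← map_natCast (algebraMap R _),
        ← Algebra.smul_def] at h
      have h' := P.smul_mem (algebraMap ℚ R ((n + 1 : ℕ) : ℚ)⁻¹) h
      rwa [smul_smul, ← map_natCast (algebraMap ℚ R), ← map_mul,
        inv_mul_cancel₀ (by positivity), map_one, one_smul] at h'
  have hmul : ∀ f : SymmetricAlgebra R L, ∀ g ∈ P, f * g ∈ P := by
    intro f
    induction f using SymmetricAlgebra.induction with
    | algebraMap r => intro g hg; rw [← Algebra.smul_def]; exact P.smul_mem r hg
    | ι x => exact hι x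
    | mul a b ha hb => intro g hg; rw [mul_assoc]; exact ha _ (hb _ hg)
    | add a b ha hb => intro g hg; rw [add_mul]; exact P.add_mem (ha _ hg) (hb _ hg)
  refine eq_top_iff.2 fun f _ => ?_
  simpa using hmul f 1 (by simpa using hmem 0 0)

theorem linearMap_ext_pow {M : Type*} [AddCommGroup M] [Module R M]
    {f g : SymmetricAlgebra R L →ₗ[R] M} (h : ∀ y n, f (ι R L y ^ n) = g (ι R L y ^ n)) : f = g :=
  LinearMap.ext_on_range span_range_pow fun p => h p.1 p.2

theorem linearMap_ext_dividedPow {M : Type*} [AddCommGroup M] [Module R M]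
    {f g : SymmetricAlgebra R L →ₗ[R] M}
    (h : ∀ y n, f (dividedPow R (ι R L y) n) = g (dividedPow R (ι R L y) n)) : f = g :=
  linearMap_ext_pow fun y n => by
    rw [← factorial_smul_dividedPow R, map_smul, map_smul, h]

theorem comul_dividedPow (y : L) (n : ℕ) :
    Coalgebra.comul (R := R) (dividedPow R (ι R L y) n) =
      ∑ p ∈ antidiagonal n, dividedPow R (ι R L y) p.1 ⊗ₜ[R] dividedPow R (ι R L y) p.2 := by
  have h1 : ∀ i, (dividedPow R (ι R L y) i ⊗ₜ[R] (1 : SymmetricAlgebra R L)) =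
      dividedPow R (ι R L y ⊗ₜ[R] (1 : SymmetricAlgebra R L)) i := fun i =>
    map_dividedPow R (Algebra.TensorProduct.includeLeft (S := R)) _ _
  have h2 : ∀ i, ((1 : SymmetricAlgebra R L) ⊗ₜ[R] dividedPow R (ι R L y) i) =
      dividedPow R ((1 : SymmetricAlgebra R L) ⊗ₜ[R] ι R L y) i := fun i =>
    map_dividedPow R (Algebra.TensorProduct.includeRight :
      SymmetricAlgebra R L →ₐ[R] SymmetricAlgebra R L ⊗[R] SymmetricAlgebra R L) _ _
  rw [← Bialgebra.comulAlgHom_apply, map_dividedPow, Bialgebra.comulAlgHom_apply, comul_ι,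
    dividedPow_add R (by simp [commute_iff_eq])]
  refine sum_congr rfl fun p _ => ?_
  rw [← h1, ← h2, Algebra.TensorProduct.tmul_mul_tmul, mul_one, one_mul]

end Module

section Lie

variable {L : Type*} [LieRing L] [LieAlgebra R L]
attribute [local instance] LieRing.ofAssociativeRing

variable {E : SymmetricAlgebra R L →ₗ[R] Module.End R L}

theorem apply_dividedPow_of_apply_pow
    (hE : ∀ y n, E (ι R L y ^ n) = algebraMap ℚ R (bernoulli n) • LieAlgebra.ad R L y ^ n)
    (y : L) (n : ℕ) :
    E (dividedPow R (ι R L y) n) = bernoulliCoeff R n • LieAlgebra.ad R L y ^ n := by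
  rw [dividedPow, map_smul, hE, smul_smul, ← map_mul, mul_comm, ← div_eq_mul_inv, bernoulliCoeff]

theorem apply_ι_mul_dividedPow_of_apply_pow
    (hE : ∀ y n, E (ι R L y ^ n) = algebraMap ℚ R (bernoulli n) • LieAlgebra.ad R L y ^ n)
    (w y : L) (n : ℕ) :
    E (ι R L w * dividedPow R (ι R L y) n) = bernoulliCoeff R (n + 1) •
      ∑ p ∈ antidiagonal n,
        LieAlgebra.ad R L y ^ p.1 * LieAlgebra.ad R L w * LieAlgebra.ad R L y ^ p.2 := by
  let P : Submodule R (SymmetricAlgebra R L × Module.End R L) :=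
    LinearMap.eqLocus (E ∘ₗ LinearMap.fst R _ _)
      (algebraMap ℚ R (bernoulli (n + 1)) • LinearMap.snd R _ _)
  have h := P.sum_pow_mul_mul_pow_mem (ι R L y, LieAlgebra.ad R L y) (ι R L w, LieAlgebra.ad R L w)
    n fun k => by
      have := hE (y + k • w) (n + 1)
      simpa [P, smul_sum] using this
  have h' : E (∑ p ∈ antidiagonal n, ι R L y ^ p.1 * ι R L w * ι R L y ^ p.2) =
      algebraMap ℚ R (bernoulli (n + 1)) • ∑ p ∈ antidiagonal n,
        LieAlgebra.ad R L y ^ p.1 * LieAlgebra.ad R L w * LieAlgebra.ad R L y ^ p.2 := by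
    simpa [P, Prod.fst_sum, Prod.snd_sum, smul_sum] using h
  rw [sum_antidiagonal_pow_mul_mul_pow, ← map_natCast (algebraMap R _), ← Algebra.smul_def,
    map_smul] at h'
  apply eq_of_natCast_succ_smul_eq (R := R) (n := n)
  rw [dividedPow, mul_smul_comm, map_smul, smul_smul, mul_comm, ← smul_smul, h', smul_smul,
    smul_smul, bernoulliCoeff, ← map_natCast (algebraMap ℚ R), ← map_mul, ← map_mul]
  congr 2
  rw [Nat.factorial_succ, Nat.cast_mul]
  field_simp

variable (E) in
/-- The convolution of the identity of the symmetric algebra with the evaluation of `E` at `x`. -/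
noncomputable def leftMul (x : L) : Module.End R (SymmetricAlgebra R L) :=
  LinearMap.mul' R _ ∘ₗ LinearMap.lTensor _ (ι R L ∘ₗ E.flip x) ∘ₗ Coalgebra.comul

theorem leftMul_dividedPow (x y : L) (n : ℕ) :
    leftMul E x (dividedPow R (ι R L y) n) = ∑ p ∈ antidiagonal n,
      dividedPow R (ι R L y) p.1 * ι R L (E (dividedPow R (ι R L y) p.2) x) := by
  simp [leftMul, comul_dividedPow]

theorem leftMul_ι_mul_dividedPow (x w y : L) (n : ℕ) :
    leftMul E x (ι R L w * dividedPow R (ι R L y) n) =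
      ι R L w * leftMul E x (dividedPow R (ι R L y) n) + ∑ p ∈ antidiagonal n,
      dividedPow R (ι R L y) p.1 * ι R L (E (ι R L w * dividedPow R (ι R L y) p.2) x) := by
  rw [leftMul_dividedPow]
  simp [leftMul, comul_dividedPow, Bialgebra.comul_mul, add_mul, mul_sum, sum_add_distrib,
    mul_assoc]

theorem leftMul_leftMul_dividedPow (x z y : L) (n : ℕ) :
    leftMul E x (leftMul E z (dividedPow R (ι R L y) n)) =
      PowerSeries.coeff n (PowerSeries.mk (fun i => dividedPow R (ι R L y) i) *
        PowerSeries.mk (fun i => ι R L (E (dividedPow R (ι R L y) i) x)) *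
        PowerSeries.mk (fun i => ι R L (E (dividedPow R (ι R L y) i) z))) +
      ∑ p ∈ antidiagonal n, dividedPow R (ι R L y) p.1 * ι R L (∑ q ∈ antidiagonal p.2,
        E (ι R L (E (dividedPow R (ι R L y) q.1) z) * dividedPow R (ι R L y) q.2) x) := by
  simp only [map_sum, mul_sum]
  rw [← sum_antidiagonal_sum_antidiagonal_assoc n fun a b j => dividedPow R (ι R L y) a *
    ι R L (E (ι R L (E (dividedPow R (ι R L y) j) z) * dividedPow R (ι R L y) b) x)]
  rw [leftMul_dividedPow, map_sum, PowerSeries.coeff_mul, ← sum_add_distrib]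
  refine sum_congr rfl fun p _ => ?_
  rw [mul_comm, leftMul_ι_mul_dividedPow, leftMul_dividedPow, PowerSeries.coeff_mul]
  simp [mul_comm]

theorem leftMul_lie
    (hE : ∀ y n, E (ι R L y ^ n) = algebraMap ℚ R (bernoulli n) • LieAlgebra.ad R L y ^ n)
    (x z : L) : leftMul E ⁅x, z⁆ = ⁅leftMul E x, leftMul E z⁆ := by
  refine linearMap_ext_dividedPow fun y n => ?_
  rw [LieRing.of_associative_ring_bracket, LinearMap.sub_apply, Module.End.mul_apply,
    Module.End.mul_apply, leftMul_leftMul_dividedPow, leftMul_leftMul_dividedPow,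
    mul_right_comm, add_sub_add_left_eq_sub, ← sum_sub_distrib, leftMul_dividedPow]
  refine sum_congr rfl fun p _ => ?_
  rw [← mul_sub, ← map_sub, apply_dividedPow_of_apply_pow hE, LinearMap.smul_apply,
    ← sum_bernoulliCoeff_smul_ad_pow_lie]
  simp only [apply_dividedPow_of_apply_pow hE, apply_ι_mul_dividedPow_of_apply_pow hE]
  simp only [mul_smul, smul_sum, map_sub, map_sum, LinearMap.smul_apply, LinearMap.sum_apply,
    map_smul, Module.End.mul_apply, LieAlgebra.ad_apply, smul_mul_assoc, mul_smul_comm]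
  refine congrArg _ (congrArg₂ _ ?_ ?_) <;>
    exact sum_congr rfl fun _ _ => sum_congr rfl fun _ _ => smul_comm _ _ _

/-- The Lie algebra representation on the symmetric algebra given by `leftMul`. -/
noncomputable def leftMulLieHom
    (hE : ∀ y n, E (ι R L y ^ n) = algebraMap ℚ R (bernoulli n) • LieAlgebra.ad R L y ^ n) :
    L →ₗ⁅R⁆ Module.End R (SymmetricAlgebra R L) where
  toFun := leftMul E
  map_add' x z := linearMap_ext_dividedPow fun y n => by
    simp [leftMul_dividedPow, mul_add, sum_add_distrib]
  map_smul' r x := linearMap_ext_dividedPow fun y n => by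
    simp [leftMul_dividedPow, smul_sum]
  map_lie' {x z} := leftMul_lie hE x z

theorem leftMul_self_pow
    (hE : ∀ y n, E (ι R L y ^ n) = algebraMap ℚ R (bernoulli n) • LieAlgebra.ad R L y ^ n)
    (y : L) (n : ℕ) : leftMul E y (ι R L y ^ n) = ι R L y ^ (n + 1) := by
  have h0 : ∀ k, E (dividedPow R (ι R L y) (k + 1)) y = 0 := fun k => by
    simp [apply_dividedPow_of_apply_pow hE, pow_succ]
  have h1 : E (dividedPow R (ι R L y) 0) y = y := by
    simp [apply_dividedPow_of_apply_pow hE, bernoulliCoeff]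
  rw [← factorial_smul_dividedPow R, map_smul, leftMul_dividedPow]
  cases n with
  | zero => simp only [Nat.antidiagonal_zero, sum_singleton, h1]; simp [dividedPow]
  | succ n =>
    rw [Finset.Nat.sum_antidiagonal_succ']
    simp only [h0, h1, map_zero, mul_zero, sum_const_zero, add_zero]
    rw [← smul_mul_assoc, factorial_smul_dividedPow, ← pow_succ]

end Lie

end SymmetricAlgebra

end Symmetric

section TensorAlgebra

variable {R : Type*} [CommRing R] {L : Type*} [AddCommGroup L] [Module R L]

theorem TensorAlgebra.span_range_list_prod : Submodule.span R
    (Set.range fun l : List L => (l.map (TensorAlgebra.ι R)).prod) = ⊤ := by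
  rw [← Algebra.top_toSubmodule, ← TensorAlgebra.adjoin_range_ι, Algebra.adjoin_eq_span]
  congr 1
  ext t
  constructor
  · rintro ⟨l, rfl⟩
    exact Submonoid.list_prod_mem _ fun t ht => by
      obtain ⟨x, -, rfl⟩ := List.mem_map.1 ht
      exact Submonoid.subset_closure ⟨x, rfl⟩
  · intro ht
    obtain ⟨l, hl, rfl⟩ := Submonoid.exists_list_of_mem_closure ht
    have hl' : l ∈ Set.range (List.map (TensorAlgebra.ι R)) := by
      rw [Set.range_list_map]; exact hl
    obtain ⟨l, rfl⟩ := hl'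
    exact ⟨l, rfl⟩

theorem TensorAlgebra.mem_span_range_list_prod (t : TensorAlgebra R L) : t ∈ Submodule.span R
    (Set.range fun l : List L => (l.map (TensorAlgebra.ι R)).prod) := by
  rw [TensorAlgebra.span_range_list_prod]
  trivial

theorem List.ofFn_get_comp_swap {α : Type*} (A B : List α) (x y : α) :
    List.ofFn ((A ++ x :: y :: B).get ∘ Equiv.swap ⟨A.length, by simp⟩ ⟨A.length + 1, by simp⟩) =
      A ++ y :: x :: B := by
  refine List.ext_getElem (by simp; omega) fun i h₁ h₂ => ?_
  simp only [List.getElem_ofFn, Function.comp_apply, Equiv.swap_apply_def, Fin.ext_iff]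
  grind

theorem TensorAlgebra.map_mul_ι_sub_ι_mul_eq_zero {M : Type*} [AddCommGroup M] [Module R M]
    (f : TensorAlgebra R L →ₗ[R] M)
    (hf : ∀ (n : ℕ) (x : Fin n → L) (τ : Equiv.Perm (Fin n)),
      f (List.ofFn fun i => TensorAlgebra.ι R (x (τ i))).prod =
        f (List.ofFn fun i => TensorAlgebra.ι R (x i)).prod)
    (a b : TensorAlgebra R L) (x y : L) :
    f (a * (TensorAlgebra.ι R x * TensorAlgebra.ι R y -
      TensorAlgebra.ι R y * TensorAlgebra.ι R x) * b) = 0 := by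
  have ha : a ∈ Submodule.span R
      (Set.range fun l : List L => (l.map (TensorAlgebra.ι R)).prod) :=
    TensorAlgebra.mem_span_range_list_prod _
  have hb : b ∈ Submodule.span R
      (Set.range fun l : List L => (l.map (TensorAlgebra.ι R)).prod) :=
    TensorAlgebra.mem_span_range_list_prod _
  induction ha, hb using Submodule.span_induction₂ (R := R) with
  | zero_left => simp
  | zero_right => simp
  | add_left _ _ _ _ _ _ h h' => rw [add_mul, add_mul, map_add, h, h', add_zero]
  | add_right _ _ _ _ _ _ h h' => rw [mul_add, map_add, h, h', add_zero]
  | smul_left r _ _ _ _ h => rw [smul_mul_assoc, smul_mul_assoc, map_smul, h, smul_zero]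
  | smul_right r _ _ _ _ h => rw [mul_smul_comm, map_smul, h, smul_zero]
  | mem_mem _ _ ha hb =>
    obtain ⟨A, rfl⟩ := ha
    obtain ⟨B, rfl⟩ := hb
    have h := hf _ (A ++ x :: y :: B).get
      (Equiv.swap ⟨A.length, by simp⟩ ⟨A.length + 1, by simp⟩)
    have h₁ := List.map_ofFn (f := (A ++ x :: y :: B).get ∘
      Equiv.swap ⟨A.length, by simp⟩ ⟨A.length + 1, by simp⟩) (g := TensorAlgebra.ι R)
    have h₂ := List.map_ofFn (f := (A ++ x :: y :: B).get) (g := TensorAlgebra.ι R)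
    rw [List.ofFn_get_comp_swap] at h₁
    rw [List.ofFn_get] at h₂
    have h' : f ((A ++ y :: x :: B).map (TensorAlgebra.ι R)).prod =
        f ((A ++ x :: y :: B).map (TensorAlgebra.ι R)).prod := by
      rw [h₁, h₂]; exact h
    simp only [List.map_append, List.map_cons, List.prod_append, List.prod_cons] at h'
    rw [mul_sub, sub_mul, map_sub, sub_eq_zero]
    simpa only [mul_assoc] using h'.symm

/-- A linear map on an algebra which respects a relation inside arbitrary products factors through
the quotient by the ring congruence generated by the relation. -/
theorem RingQuot.exists_linearMap_mkAlgHom_eq {A : Type*} [Ring A] [Algebra R A]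
    (r : A → A → Prop) {M : Type*} [AddCommGroup M] [Module R M] (f : A →ₗ[R] M)
    (hf : ∀ a b u v, r u v → f (a * u * b) = f (a * v * b)) :
    ∃ g : RingQuot r →ₗ[R] M, ∀ t, g (RingQuot.mkAlgHom R r t) = f t := by
  let c : RingCon A :=
    { r := fun u v => ∀ a b, f (a * u * b) = f (a * v * b)
      iseqv := ⟨fun _ _ _ => rfl, fun h a b => (h a b).symm,
        fun h h' a b => (h a b).trans (h' a b)⟩
      add' := fun h h' a b => by
        rw [mul_add, add_mul, map_add, h, h', ← map_add, ← add_mul, ← mul_add]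
      mul' := fun {u u' v v'} h h' a b => by
        have h₁ := h a (v * b)
        have h₂ := h' (a * u') b
        simp only [mul_assoc] at h₁ h₂ ⊢
        exact h₁.trans h₂ }
  have hker : ∀ t, RingQuot.mkAlgHom R r t = 0 → f t = 0 := by
    intro t ht
    have h := RingQuot.liftAlgHom_mkAlgHom_apply R (RingCon.mkₐ R c)
      (fun u v huv => (RingCon.eq c).2 fun a b => hf a b u v huv) t
    rw [ht, map_zero] at h
    have h' := (RingCon.eq c (a := 0) (b := t)).1 h 1 1
    simpa using h'.symm
  let q := (RingQuot.mkAlgHom R r).toLinearMap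
  have hq : Function.Surjective q := RingQuot.mkAlgHom_surjective R r
  refine ⟨(LinearMap.ker q).liftQ f (fun t ht => hker t ht) ∘ₗ
    (q.quotKerEquivOfSurjective hq).symm.toLinearMap, fun t => ?_⟩
  have : (q.quotKerEquivOfSurjective hq).symm (q t) = Submodule.Quotient.mk t := by
    rw [LinearEquiv.symm_apply_eq]; rfl
  rw [LinearMap.comp_apply, LinearEquiv.coe_coe]
  exact (congrArg _ this).trans (Submodule.liftQ_apply _ _ _)

end TensorAlgebra

section Enveloping

variable {R : Type*} [CommRing R] {L : Type*} [LieRing L] [LieAlgebra R L]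

attribute [local instance] LieRing.ofAssociativeRing

theorem UniversalEnvelopingAlgebra.ι_mul_ι_pow_sub_mem (x y : L) (n : ℕ) :
    ι R x * ι R y ^ n - ι R y ^ n * ι R x ∈
      LinearMap.range (ι R (L := L)).toLinearMap ^ n := by
  have hι : ∀ z, ι R z ∈ LinearMap.range (ι R (L := L)).toLinearMap :=
    fun z => ⟨z, rfl⟩
  induction n with
  | zero => simp
  | succ n ih =>
    have h : ι R x * ι R y ^ (n + 1) - ι R y ^ (n + 1) * ι R x =
        (ι R x * ι R y ^ n - ι R y ^ n * ι R x) * ι R y + ι R y ^ n * ι R ⁅x, y⁆ := by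
      rw [LieHom.map_lie, LieRing.of_associative_ring_bracket]
      noncomm_ring
    rw [h, pow_succ]
    exact add_mem (Submodule.mul_mem_mul ih (hι _))
      (Submodule.mul_mem_mul (Submodule.pow_mem_pow _ (hι _) _) (hι _))

variable [Algebra ℚ R]

theorem SymmetricAlgebra.injective_of_apply_ι_pow
    (e : SymmetricAlgebra R L →ₗ[R] UniversalEnvelopingAlgebra R L)
    (he : ∀ y n, e (SymmetricAlgebra.ι R L y ^ n) = UniversalEnvelopingAlgebra.ι R y ^ n) :
    Function.Injective e := by
  let E : SymmetricAlgebra R L →ₗ[R] Module.End R L :=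
    (UniversalEnvelopingAlgebra.lift R (LieAlgebra.ad R L)).toLinearMap ∘ₗ e ∘ₗ
      degreeScale fun n => algebraMap ℚ R (bernoulli n)
  have hE : ∀ y n, E (SymmetricAlgebra.ι R L y ^ n) =
      algebraMap ℚ R (bernoulli n) • LieAlgebra.ad R L y ^ n := fun y n => by
    simp only [E, LinearMap.comp_apply, degreeScale_pow, map_smul, he, AlgHom.toLinearMap_apply,
      map_pow, UniversalEnvelopingAlgebra.lift_ι_apply]
  let π : UniversalEnvelopingAlgebra R L →ₗ[R] SymmetricAlgebra R L :=
    LinearMap.applyₗ 1 ∘ₗ (UniversalEnvelopingAlgebra.lift R (leftMulLieHom hE)).toLinearMap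
  have hπ : ∀ y n, π (UniversalEnvelopingAlgebra.ι R y ^ n) = SymmetricAlgebra.ι R L y ^ n := by
    intro y n
    simp only [π, LinearMap.comp_apply, AlgHom.toLinearMap_apply, map_pow,
      UniversalEnvelopingAlgebra.lift_ι_apply, LinearMap.applyₗ_apply_apply]
    induction n with
    | zero => simp
    | succ n ih =>
      rw [pow_succ', Module.End.mul_apply, ih]
      exact leftMul_self_pow hE y n
  have h : π ∘ₗ e = LinearMap.id := linearMap_ext_pow fun y n => by
    rw [LinearMap.comp_apply, he, hπ, LinearMap.id_apply]
  exact Function.LeftInverse.injective (g := π) fun s => LinearMap.congr_fun h s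

namespace UniversalEnvelopingAlgebra

theorem range_ι_pow_le (n : ℕ) :
    LinearMap.range (ι R (L := L)).toLinearMap ^ n ≤
      Submodule.span R {u | ∃ y, ∃ m ≤ n, ι R y ^ m = u} := by
  induction n using Nat.strong_induction_on with
  | _ n ih =>
  cases n with
  | zero =>
    rw [pow_zero, Submodule.one_eq_span, Submodule.span_singleton_le_iff_mem]
    exact Submodule.subset_span ⟨0, 0, le_rfl, pow_zero _⟩
  | succ n =>
    rw [pow_succ', Submodule.mul_le]
    rintro _ ⟨x, rfl⟩ b hb
    replace hb := ih n n.lt_succ_self hb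
    induction hb using Submodule.span_induction with
    | zero => simp
    | add _ _ _ _ h h' => rw [mul_add]; exact add_mem h h'
    | smul r _ _ h => rw [mul_smul_comm]; exact Submodule.smul_mem _ r h
    | mem _ hu =>
      obtain ⟨y, m, hm, rfl⟩ := hu
      set P := Submodule.span R
        {u : UniversalEnvelopingAlgebra R L | ∃ y, ∃ m ≤ n + 1, ι R y ^ m = u} with hP
      have h₁ : ∑ p ∈ antidiagonal m, ι R y ^ p.1 * ι R x * ι R y ^ p.2 ∈ P :=
        P.sum_pow_mul_mul_pow_mem _ _ m fun k => by
          rw [← map_nsmul, ← map_add]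
          exact Submodule.subset_span ⟨_, _, by omega, rfl⟩
      have h₂ : ∑ p ∈ antidiagonal m,
          (ι R x * ι R y ^ p.1 - ι R y ^ p.1 * ι R x) * ι R y ^ p.2 ∈ P := by
        refine sum_mem fun p hp => ?_
        have h := Submodule.mul_mem_mul (ι_mul_ι_pow_sub_mem (R := R) x y p.1)
          (Submodule.pow_mem_pow _ (show ι R y ∈ LinearMap.range
            (ι R (L := L)).toLinearMap from ⟨y, rfl⟩) p.2)
        rw [← pow_add, HasAntidiagonal.mem_antidiagonal.1 hp] at h
        refine Submodule.span_mono ?_ (ih m (by omega) h)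
        rintro _ ⟨z, k, hk, rfl⟩
        exact ⟨z, k, by omega, rfl⟩
      have h₃ := add_mem h₁ h₂
      rw [← sum_add_distrib, sum_congr rfl (g := fun _ => ι R x * ι R y ^ m) fun p hp => by
        rw [← HasAntidiagonal.mem_antidiagonal.1 hp, pow_add]; noncomm_ring, sum_const,
        Finset.Nat.card_antidiagonal, ← Nat.cast_smul_eq_nsmul R] at h₃
      have h₄ := P.smul_mem (algebraMap ℚ R ((m + 1 : ℕ) : ℚ)⁻¹) h₃
      rwa [smul_smul, ← map_natCast (algebraMap ℚ R), ← map_mul,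
        inv_mul_cancel₀ (by positivity), map_one, one_smul] at h₄

/-- Over a `ℚ`-algebra, the universal enveloping algebra is spanned by powers of elements of the
Lie algebra. -/
theorem span_range_pow : Submodule.span R
    (Set.range fun p : L × ℕ => ι R p.1 ^ p.2) = ⊤ := by
  refine eq_top_iff.2 ?_
  rintro u -
  obtain ⟨t, rfl⟩ : ∃ t, mkAlgHom R L t = u := Quotient.mk_surjective u
  have ht : t ∈ Submodule.span R
      (Set.range fun l : List L => (l.map (TensorAlgebra.ι R)).prod) :=
    TensorAlgebra.mem_span_range_list_prod _
  induction ht using Submodule.span_induction with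
  | zero => simp
  | add _ _ _ _ h h' => rw [map_add]; exact add_mem h h'
  | smul r _ _ h => rw [map_smul]; exact Submodule.smul_mem _ r h
  | mem _ h =>
    obtain ⟨l, rfl⟩ := h
    have hl : mkAlgHom R L (l.map (TensorAlgebra.ι R)).prod ∈
        LinearMap.range (ι R (L := L)).toLinearMap ^ l.length := by
      induction l with
      | nil => exact ⟨1, by simp⟩
      | cons x l ih =>
        rw [List.map_cons, List.prod_cons, map_mul, List.length_cons, pow_succ']
        exact Submodule.mul_mem_mul ⟨x, rfl⟩ ih
    refine Submodule.span_mono ?_ (range_ι_pow_le _ hl)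
    rintro _ ⟨y, m, -, rfl⟩
    exact ⟨(y, m), rfl⟩

end UniversalEnvelopingAlgebra

theorem SymmetricAlgebra.bijective_of_apply_ι_pow
    (e : SymmetricAlgebra R L →ₗ[R] UniversalEnvelopingAlgebra R L)
    (he : ∀ y n, e (SymmetricAlgebra.ι R L y ^ n) = UniversalEnvelopingAlgebra.ι R y ^ n) :
    Function.Bijective e := by
  refine ⟨injective_of_apply_ι_pow e he, LinearMap.range_eq_top.1 (eq_top_iff.2 ?_)⟩
  rw [← UniversalEnvelopingAlgebra.span_range_pow, Submodule.span_le]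
  rintro _ ⟨⟨y, n⟩, rfl⟩
  exact ⟨_, he y n⟩

end Enveloping

/-- The quotient of the tensor algebra by `symRel` is the symmetric algebra. -/
noncomputable def symRelEquiv (R : Type*) [CommRing R] (L : Type*) [AddCommGroup L] [Module R L] :
    SymmetricAlgebra R L ≃ₐ[R] RingQuot (symRel R L) :=
  AlgEquiv.ofAlgHom
    (RingCon.liftₐ _ (RingQuot.mkAlgHom R (symRel R L)) (RingCon.ringConGen_le.2 (by
      rintro _ _ ⟨x, y⟩
      exact RingQuot.mkAlgHom_rel R ⟨x, y, rfl, rfl⟩)))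
    (RingQuot.liftAlgHom R ⟨SymmetricAlgebra.algHom R L, by
      rintro _ _ ⟨x, y, rfl, rfl⟩
      simp only [map_mul, mul_comm]⟩)
    (by
      ext x
      exact congrArg (RingCon.liftₐ _ _ _) (RingQuot.liftAlgHom_mkAlgHom_apply R _ _ _))
    (by
      ext x
      exact RingQuot.liftAlgHom_mkAlgHom_apply R _ _ _)

theorem symRelEquiv_ι (R : Type*) [CommRing R] (L : Type*) [AddCommGroup L] [Module R L] (x : L) :
    symRelEquiv R L (SymmetricAlgebra.ι R L x) =
      RingQuot.mkAlgHom R (symRel R L) (TensorAlgebra.ι R x) :=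
  rfl

end

/-- **The classical Poincaré symmetrization map is an isomorphism**
(Proposition 2.2 of the paper, ungraded content, with no freeness hypothesis).
Over a commutative `ℚ`-algebra `R`, let `e' : T(L) → U[L]` be the `R`-linear
map which is the identity on the degree-0 part and is given on the `n`-th
tensor power by `e'(x₁ ⊗ ⋯ ⊗ xₙ) = (1/n!) ∑_{σ ∈ Sₙ} ι(x_{σ(1)}) ⋯ ι(x_{σ(n)})`.
Then `e'` kills the two-sided ideal of `T(L)` generated by the elements
`x ⊗ y − y ⊗ x`, hence induces an `R`-linear map `e : S(L) → U[L]` on the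
symmetric algebra, and `e` is an isomorphism of `R`-modules. -/
theorem poincare_symmetrization_isomorphism
    (R : Type*) [CommRing R] [Algebra ℚ R]
    (L : Type*) [LieRing L] [LieAlgebra R L]
    (e' : TensorAlgebra R L →ₗ[R] UniversalEnvelopingAlgebra R L)
    (he'0 : ∀ r : R, e' (algebraMap R (TensorAlgebra R L) r) =
      algebraMap R (UniversalEnvelopingAlgebra R L) r)
    (he' : ∀ (n : ℕ) (x : Fin n → L),
      e' ((List.ofFn fun i => TensorAlgebra.ι R (x i)).prod) =
        algebraMap ℚ R ((n.factorial : ℚ)⁻¹) •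
          ∑ σ : Equiv.Perm (Fin n),
            (List.ofFn fun i => UniversalEnvelopingAlgebra.ι R (x (σ i))).prod) :
    (∀ (a b : TensorAlgebra R L) (x y : L),
        e' (a * (TensorAlgebra.ι R x * TensorAlgebra.ι R y -
          TensorAlgebra.ι R y * TensorAlgebra.ι R x) * b) = 0) ∧
      ∃ e : RingQuot (symRel R L) →ₗ[R] UniversalEnvelopingAlgebra R L,
        (∀ t : TensorAlgebra R L, e (RingQuot.mkAlgHom R (symRel R L) t) = e' t) ∧
          Function.Bijective e := by
  have hperm : ∀ (n : ℕ) (x : Fin n → L) (τ : Equiv.Perm (Fin n)),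
      e' (List.ofFn fun i => TensorAlgebra.ι R (x (τ i))).prod =
        e' (List.ofFn fun i => TensorAlgebra.ι R (x i)).prod := fun n x τ => by
    rw [he' n fun i => x (τ i), he' n x]
    exact congrArg _ (Equiv.sum_comp (Equiv.mulLeft τ) fun σ =>
      (List.ofFn fun i => UniversalEnvelopingAlgebra.ι R (x (σ i))).prod)
  have hzero := TensorAlgebra.map_mul_ι_sub_ι_mul_eq_zero e' hperm
  refine ⟨hzero, ?_⟩
  obtain ⟨e, he⟩ := RingQuot.exists_linearMap_mkAlgHom_eq (symRel R L) e' fun a b u v huv => by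
    obtain ⟨x, y, rfl, rfl⟩ := huv
    rw [← sub_eq_zero, ← map_sub, ← sub_mul, ← mul_sub, hzero]
  refine ⟨e, he, ?_⟩
  have hpow : ∀ y n, e' (TensorAlgebra.ι R y ^ n) = UniversalEnvelopingAlgebra.ι R y ^ n := by
    intro y n
    have h := he' n fun _ => y
    simp only [List.ofFn_const, List.prod_replicate, Finset.sum_const, Finset.card_univ,
      Fintype.card_perm, Fintype.card_fin] at h
    rw [h, ← Nat.cast_smul_eq_nsmul R, smul_smul, ← map_natCast (algebraMap ℚ R), ← map_mul,
      inv_mul_cancel₀ (by positivity), map_one, one_smul]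
  have h := SymmetricAlgebra.bijective_of_apply_ι_pow (e ∘ₗ (symRelEquiv R L).toLinearMap)
    fun y n => by
      rw [LinearMap.comp_apply, AlgEquiv.toLinearMap_apply, map_pow, symRelEquiv_ι, ← map_pow, he,
        hpow]
  rw [LinearMap.coe_comp] at h
  exact (Function.Bijective.of_comp_iff e (symRelEquiv R L).bijective).1 h
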